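/- Let G = (N, v) be an inessential characteristic function game with |N| = n ≥ 2, i.e., there exist individual contributions (v_i)_{i ∈ N} in ℝ such that v(C) = Σ_{i ∈ C} v_i for every C ⊆ N. Then for every agent i ∈ N, EV_i(G) = v_i − (1/(n−1)) Σ_{j ∈ N∖{i}} v_j, which equals (1 + 1/(n−1)) · v_i − (1/(n−1)) Σ_{j ∈ N} v_j. -/

import Mathlib

open Finset

/-- The set of all permutations (encoded as lists) of the elements of a finset `s`.
For a nodup base list this is exactly the set `Π_s` of orderings of `s`. -/
noncomputable def permsOf {α : Type*} [DecidableEq α] (s : Finset α) : Finset (List α) :=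
  s.toList.permutations.toFinset

/-- The Shapley Value of agent `i` in the characteristic function game on the
(full, finite) agent set `α` with characteristic function `v`:
`SV_i = (1/n!) ∑_{m=0}^{n-1} ∑_{π ∈ Π_{N∖{i}}} (v (S_π(m) ∪ {i}) - v (S_π(m)))`,
where `S_π(m)` is the set of the first `m` entries of `π`. -/
noncomputable def ShapleyValue {α : Type*} [Fintype α] [DecidableEq α]
    (v : Finset α → ℝ) (i : α) : ℝ :=
  (((Fintype.card α).factorial : ℝ))⁻¹ *
    ∑ π ∈ permsOf (Finset.univ.erase i), ∑ m ∈ Finset.range (Fintype.card α),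
      (v (insert i (π.take m).toFinset) - v (π.take m).toFinset)

/-- The Exchange Value of agent `i`:
`EV_i = (1/((n-1)!·(n-1))) ∑_{m=1}^{n-1} ∑_{π ∈ Π_{N∖{i}}} (v (S_π(m-1) ∪ {i}) - v (S_π(m)))`. -/
noncomputable def ExchangeValue {α : Type*} [Fintype α] [DecidableEq α]
    (v : Finset α → ℝ) (i : α) : ℝ :=
  ((((Fintype.card α - 1).factorial * (Fintype.card α - 1) : ℕ) : ℝ))⁻¹ *
    ∑ π ∈ permsOf (Finset.univ.erase i), ∑ m ∈ Finset.Icc 1 (Fintype.card α - 1),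
      (v (insert i (π.take (m - 1)).toFinset) - v (π.take m).toFinset)

theorem mem_permsOf {α : Type*} [DecidableEq α] {s : Finset α} {π : List α} :
    π ∈ permsOf s ↔ π.Perm s.toList := by
  simp [permsOf]

theorem card_permsOf {α : Type*} [DecidableEq α] (s : Finset α) :
    (permsOf s).card = s.card.factorial := by
  rw [permsOf, List.toFinset_card_of_nodup (List.nodup_permutations _ s.nodup_toList),
    List.length_permutations, Finset.length_toList]

/-- In an additive game, the exchange contributions of `i` along a list avoiding `i` telescope. -/
theorem sum_exchange_contribution_additive {α : Type*} [DecidableEq α]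
    {v : Finset α → ℝ} {w : α → ℝ} (hw : ∀ C : Finset α, v C = ∑ j ∈ C, w j)
    {i : α} {π : List α} (hi : i ∉ π) (k : ℕ) :
    ∑ m ∈ Finset.Icc 1 k, (v (insert i (π.take (m - 1)).toFinset) - v (π.take m).toFinset)
      = k * w i - ∑ j ∈ (π.take k).toFinset, w j := by
  induction k with
  | zero => simp
  | succ k ih =>
    have hk : i ∉ (π.take k).toFinset := fun h => hi (List.mem_of_mem_take (by simpa using h))
    rw [Finset.sum_Icc_succ_top (by omega), ih, Nat.add_sub_cancel, hw, hw,
      Finset.sum_insert hk]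
    push_cast
    ring

/-- In an inessential game, where `v C = ∑_{j ∈ C} w j` for individual contributions `w`,
the Exchange Value of agent `i` is
`EV_i(G) = w i − (1/(n−1)) ∑_{j ∈ N∖{i}} w j = (1 + 1/(n−1)) w i − (1/(n−1)) ∑_{j ∈ N} w j`. -/
theorem exchangeValue_inessential
    {α : Type*} [Fintype α] [DecidableEq α]
    (hn : 2 ≤ Fintype.card α) (v : Finset α → ℝ) (w : α → ℝ)
    (hw : ∀ C : Finset α, v C = ∑ j ∈ C, w j) (i : α) :
    ExchangeValue v i
        = w i - (1 / ((Fintype.card α : ℝ) - 1)) * ∑ j ∈ Finset.univ.erase i, w j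
      ∧ ExchangeValue v i
        = (1 + 1 / ((Fintype.card α : ℝ) - 1)) * w i
            - (1 / ((Fintype.card α : ℝ) - 1)) * ∑ j : α, w j := by
  have hcard : (Finset.univ.erase i).card = Fintype.card α - 1 := by
    rw [Finset.card_erase_of_mem (Finset.mem_univ i), Finset.card_univ]
  have hsum : ∀ π ∈ permsOf (Finset.univ.erase i),
      ∑ m ∈ Finset.Icc 1 (Fintype.card α - 1),
        (v (insert i (π.take (m - 1)).toFinset) - v (π.take m).toFinset)
      = ((Fintype.card α - 1 : ℕ) : ℝ) * w i - ∑ j ∈ Finset.univ.erase i, w j := by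
    intro π hπ
    have hp := mem_permsOf.1 hπ
    have hi : i ∉ π := fun h => by simpa using hp.mem_iff.1 h
    have hlen : π.length = Fintype.card α - 1 := by
      rw [hp.length_eq, Finset.length_toList, hcard]
    rw [sum_exchange_contribution_additive hw hi, List.take_of_length_le hlen.le,
      List.toFinset_eq_of_perm _ _ hp, Finset.toList_toFinset]
  have hn' : (Fintype.card α : ℝ) - 1 ≠ 0 := by
    have : (2 : ℝ) ≤ Fintype.card α := by exact_mod_cast hn
    linarith
  have hfac : ((Fintype.card α - 1).factorial : ℝ) ≠ 0 := by positivity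
  have hEV : ExchangeValue v i
      = w i - (1 / ((Fintype.card α : ℝ) - 1)) * ∑ j ∈ Finset.univ.erase i, w j := by
    rw [ExchangeValue, Finset.sum_congr rfl hsum, Finset.sum_const, card_permsOf, hcard,
      nsmul_eq_mul, Nat.cast_mul, Nat.cast_sub (by omega : 1 ≤ Fintype.card α), Nat.cast_one]
    field_simp
  refine ⟨hEV, ?_⟩
  rw [hEV, ← Finset.add_sum_erase _ w (Finset.mem_univ i)]
  ring
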